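/- For every complex number z with 0 < |z| < π, z·cot(z) = 1 − 2 · ∑_{n=1}^∞ ζ(2n) · z^{2n} / π^{2n}, where the series on the right converges. -/

import Mathlib

open scoped Real

/-- The Mittag-Leffler expansion of the cotangent, as a sum over `m ≥ 1` of
`x² / (m² - x²)`. -/
lemma hasSum_cot_mittagLeffler {x : ℂ} (hx : x ∈ Complex.integerComplement) :
    HasSum (fun m : ℕ => x ^ 2 / ((m + 1 : ℂ) ^ 2 - x ^ 2))
      ((1 - π * x * Complex.cot (π * x)) / 2) := by
  have hx0 : x ≠ 0 := Complex.integerComplement.ne_zero hx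
  have h := ((summable_cotTerm hx).hasSum.mul_left (-x / 2))
  have hterm (m : ℕ) : -x / 2 * cotTerm x m = x ^ 2 / ((m + 1 : ℂ) ^ 2 - x ^ 2) := by
    have h1 : x - (m + 1) ≠ 0 := by
      simpa [sub_eq_add_neg] using Complex.integerComplement_add_ne_zero hx (-(m + 1))
    have h2 : x + (m + 1) ≠ 0 := by
      simpa using Complex.integerComplement_add_ne_zero hx (m + 1)
    have h3 : (m + 1 : ℂ) ^ 2 - x ^ 2 ≠ 0 := by
      rw [show (m + 1 : ℂ) ^ 2 - x ^ 2 = -((x - (m + 1)) * (x + (m + 1))) by ring]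
      exact neg_ne_zero.mpr (mul_ne_zero h1 h2)
    rw [cotTerm]
    field_simp
    ring
  have hval : ∑' m, cotTerm x m = π * Complex.cot (π * x) - 1 / x := (cot_series_rep' hx).symm
  simp only [hterm, hval] at h
  have hlim : -x / 2 * (π * Complex.cot (π * x) - 1 / x)
      = (1 - π * x * Complex.cot (π * x)) / 2 := by
    field_simp
    ring
  rwa [hlim] at h

/-- Expanding each `x² / (m² - x²)` as a geometric series turns the sum over `m ≥ 1` into the
power series with coefficients `ζ(2k)`. -/
lemma hasSum_riemannZeta_even_mul_pow {x s : ℂ} (hx : ‖x‖ < 1)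
    (hs : HasSum (fun m : ℕ => x ^ 2 / ((m + 1 : ℂ) ^ 2 - x ^ 2)) s) :
    HasSum (fun n : ℕ => riemannZeta (2 * (n + 1)) * x ^ (2 * (n + 1))) s := by
  have hr : ‖x‖ ^ 2 < 1 := pow_lt_one₀ (norm_nonneg x) hx two_ne_zero
  have hm (m : ℕ) : (m + 1 : ℂ) ≠ 0 := Nat.cast_add_one_ne_zero m
  have hsq : Summable fun m : ℕ => 1 / (m + 1 : ℝ) ^ 2 := by
    simpa using (summable_nat_add_iff 1).mpr (Real.summable_one_div_nat_pow.mpr one_lt_two)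
  have hgeom : Summable fun k : ℕ => (‖x‖ ^ 2) ^ (k + 1) :=
    (summable_nat_add_iff 1).mpr (summable_geometric_of_lt_one (by positivity) hr)
  have hsum : Summable fun p : ℕ × ℕ => (x ^ 2 / (p.1 + 1 : ℂ) ^ 2) ^ (p.2 + 1) := by
    refine .of_norm_bounded (hsq.mul_of_nonneg hgeom (fun _ => by positivity)
      fun _ => by positivity) fun p => ?_
    have hnorm : ‖(p.1 + 1 : ℂ)‖ = (p.1 + 1 : ℝ) := by
      exact_mod_cast Complex.norm_natCast (p.1 + 1)
    have hle : (1 / (p.1 + 1 : ℝ) ^ 2) ≤ 1 := by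
      rw [div_le_one (by positivity)]
      exact one_le_pow₀ (by simp)
    rw [norm_pow, norm_div, norm_pow, norm_pow, hnorm, div_eq_mul_one_div, mul_pow, mul_comm]
    gcongr
    exact pow_le_of_le_one (by positivity) hle (Nat.succ_ne_zero _)
  have hfiber_geom (m : ℕ) : HasSum (fun k : ℕ => (x ^ 2 / (m + 1 : ℂ) ^ 2) ^ (k + 1))
      (x ^ 2 / ((m + 1 : ℂ) ^ 2 - x ^ 2)) := by
    have hnorm : ‖(m + 1 : ℂ)‖ = (m + 1 : ℝ) := by
      exact_mod_cast Complex.norm_natCast (m + 1)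
    have hq : ‖x ^ 2 / (m + 1 : ℂ) ^ 2‖ < 1 := by
      rw [norm_div, norm_pow, norm_pow, hnorm, div_lt_one (by positivity)]
      exact hr.trans_le (one_le_pow₀ (by simp))
    have h := (hasSum_geometric_of_norm_lt_one hq).mul_left (x ^ 2 / (m + 1 : ℂ) ^ 2)
    simp only [← pow_succ'] at h
    rwa [← div_eq_mul_inv, div_div, mul_sub, mul_one,
      mul_div_cancel₀ _ (pow_ne_zero 2 (hm m))] at h
  have hfiber_zeta (k : ℕ) : HasSum (fun m : ℕ => (x ^ 2 / (m + 1 : ℂ) ^ 2) ^ (k + 1))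
      (riemannZeta (2 * (k + 1)) * x ^ (2 * (k + 1))) := by
    have hk : 1 < 2 * (k + 1) := by lia
    have hzeta : HasSum (fun m : ℕ => 1 / (m + 1 : ℂ) ^ (2 * (k + 1)))
        (riemannZeta (2 * (k + 1))) := by
      have hsummable : Summable fun n : ℕ => 1 / (n : ℂ) ^ (2 * (k + 1)) :=
        .of_norm <| by
        simpa using Real.summable_one_div_nat_pow.mpr hk
      have h := hsummable.hasSum
      rw [← zeta_nat_eq_tsum_of_gt_one hk, ← hasSum_nat_add_iff' 1] at h
      simpa using h
    refine (hzeta.mul_right (x ^ (2 * (k + 1)))).congr_fun fun m => ?_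
    rw [div_pow, ← pow_mul, ← pow_mul, one_div_mul_eq_div]
  have htot := hsum.hasSum
  rw [(htot.prod_fiberwise hfiber_geom).unique hs] at htot
  exact ((Equiv.prodComm ℕ ℕ).hasSum_iff.mpr htot).prod_fiberwise hfiber_zeta

/-- A nonzero complex number in the open unit disc is not an integer. -/
lemma mem_integerComplement_of_norm_lt_one {x : ℂ} (hx0 : x ≠ 0) (hx : ‖x‖ < 1) :
    x ∈ Complex.integerComplement := by
  rintro ⟨n, rfl⟩
  rw [Complex.norm_intCast] at hx
  have hn : |n| < 1 := by exact_mod_cast hx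
  exact hx0 (by simp [Int.abs_lt_one_iff.mp hn])

/-- For `0 < |z| < π`, `z·cot z = 1 − 2 ∑_{n=1}^∞ ζ(2n) z^(2n)/π^(2n)`,
the series being convergent. -/
theorem z_cot_z_zeta (z : ℂ) (hz : 0 < ‖z‖) (hz' : ‖z‖ < π) :
    HasSum (fun n : ℕ =>
        riemannZeta (2 * (n + 1)) * z ^ (2 * (n + 1)) / (π : ℂ) ^ (2 * (n + 1)))
      ((1 - z * Complex.cot z) / 2) := by
  have hpi : (π : ℂ) ≠ 0 := Complex.ofReal_ne_zero.mpr Real.pi_ne_zero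
  have hx : ‖z / π‖ < 1 := by
    rwa [norm_div, Complex.norm_real, Real.norm_of_nonneg Real.pi_nonneg,
      div_lt_one Real.pi_pos]
  have hx0 : z / π ≠ 0 := div_ne_zero (norm_pos_iff.mp hz) hpi
  have h := hasSum_riemannZeta_even_mul_pow hx
    (hasSum_cot_mittagLeffler (mem_integerComplement_of_norm_lt_one hx0 hx))
  rw [mul_div_cancel₀ _ hpi] at h
  simpa only [div_pow, mul_div_assoc] using h
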